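/- Assume f is in addition μ_f-strongly convex with μ_f > 0, and assume BBᵀ = I (the r×r identity). Let λ = 1, let 0 < γ ≤ β with γM < 1, and set κ = 1/(μ_f γ(1 − γM)m) + ((m + 1)γM)/((1 − γM)m). Starting from (x̃_0, ṽ_0) with h(ṽ_0) < +∞, generate by Algorithm 1 (SVRG-PDFP) the epoch sequence (x̃_s, ṽ_s), where each epoch starts from the previous epoch's output and uses fresh independent uniform random size-b index subsets. Then for every s ≥ 0, E[R(x̃_s, ṽ_s)] ≤ κ^s · R(x̃_0, ṽ_0), without any strong convexity assumption on h. -/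

import Mathlib

open scoped RealInnerProductSpace

section Convex

variable {E : Type*} [NormedAddCommGroup E] [InnerProductSpace ℝ E]

theorem nonneg_of_forall_nonneg_add_mul {a c : ℝ}
    (H : ∀ t : ℝ, 0 < t → t ≤ 1 → 0 ≤ a + t * c) : 0 ≤ a := by
  by_contra! ha
  have hc : 0 < 1 + |c| := by positivity
  have ht : 0 < min 1 (-a / (2 * (1 + |c|))) := by
    apply lt_min one_pos; apply div_pos <;> linarith
  have h1 := H _ ht (min_le_left _ _)
  have h2 : min 1 (-a / (2 * (1 + |c|))) * c ≤ -a / (2 * (1 + |c|)) * (1 + |c|) :=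
    calc _ ≤ min 1 (-a / (2 * (1 + |c|))) * (1 + |c|) :=
          mul_le_mul_of_nonneg_left (by linarith [le_abs_self c]) ht.le
      _ ≤ _ := mul_le_mul_of_nonneg_right (min_le_right _ _) hc.le
  have h3 : -a / (2 * (1 + |c|)) * (1 + |c|) = -a / 2 := by field_simp
  linarith

variable [CompleteSpace E]

theorem HasGradientAt.hasDerivAt_line {f : E → ℝ} {g x u : E} {t : ℝ}
    (hf : HasGradientAt f g (x + t • u)) :
    HasDerivAt (fun s : ℝ => f (x + s • u)) ⟪g, u⟫ t := by
  have h1 : HasDerivAt (fun s : ℝ => x + s • u) u t := by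
    simpa using ((hasDerivAt_id t).smul_const u).const_add x
  have h2 := hf.hasFDerivAt.comp_hasDerivAt t h1
  rw [InnerProductSpace.toDual_apply_apply] at h2
  exact h2

theorem ConvexOn.add_inner_le_of_hasGradientAt {f : E → ℝ} {g x : E}
    (hf : ConvexOn ℝ Set.univ f) (hg : HasGradientAt f g x) (y : E) :
    f x + ⟪g, y - x⟫ ≤ f y := by
  have hc : ConvexOn ℝ Set.univ (fun s : ℝ => f (x + s • (y - x))) := by
    refine ⟨convex_univ, fun a _ b _ p q hp hq hpq => ?_⟩
    have := hf.2 (Set.mem_univ (x + a • (y - x))) (Set.mem_univ (x + b • (y - x))) hp hq hpq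
    convert this using 2
    simp only [smul_eq_mul]
    obtain rfl : p = 1 - q := by linarith
    module
  have hd : HasDerivAt (fun s : ℝ => f (x + s • (y - x))) ⟪g, y - x⟫ 0 :=
    HasGradientAt.hasDerivAt_line (by simpa using hg)
  have := hc.le_slope_of_hasDerivAt (Set.mem_univ 0) (Set.mem_univ 1) one_pos hd
  simp [slope_def_field] at this
  linarith

theorem le_add_inner_add_sq_of_lipschitz_gradient {f : E → ℝ} {f' : E → E} {K : ℝ}
    (hg : ∀ x, HasGradientAt f (f' x) x) (hK : ∀ x y, ‖f' x - f' y‖ ≤ K * ‖x - y‖) (x y : E) :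
    f y ≤ f x + ⟪f' x, y - x⟫ + K / 2 * ‖y - x‖ ^ 2 := by
  set u := y - x with hu
  let φ : ℝ → ℝ := fun t => f (x + t • u) - t * ⟪f' x, u⟫ - K / 2 * ‖u‖ ^ 2 * t ^ 2
  have hφ : ∀ t, HasDerivAt φ (⟪f' (x + t • u), u⟫ - ⟪f' x, u⟫ - K * ‖u‖ ^ 2 * t) t := by
    intro t
    have h1 := (HasGradientAt.hasDerivAt_line (hg (x + t • u))).sub
      ((hasDerivAt_id t).mul_const ⟪f' x, u⟫)
    have h2 := h1.sub ((hasDerivAt_pow 2 t).const_mul (K / 2 * ‖u‖ ^ 2))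
    have h3 : ⟪f' (x + t • u), u⟫ - ⟪f' x, u⟫ - K * ‖u‖ ^ 2 * t
        = ⟪f' (x + t • u), u⟫ - 1 * ⟪f' x, u⟫ - K / 2 * ‖u‖ ^ 2 * ((2 : ℕ) * t ^ (2 - 1)) := by
      norm_num; ring
    rw [h3]
    exact h2
  have hanti : AntitoneOn φ (Set.Icc 0 1) := by
    apply antitoneOn_of_deriv_nonpos (convex_Icc 0 1)
    · exact fun t _ => (hφ t).continuousAt.continuousWithinAt
    · exact fun t _ => (hφ t).differentiableAt.differentiableWithinAt
    · intro t ht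
      rw [interior_Icc] at ht
      rw [(hφ t).deriv, ← inner_sub_left]
      have h1 := real_inner_le_norm (f' (x + t • u) - f' x) u
      have h2 := hK (x + t • u) x
      rw [add_sub_cancel_left, norm_smul, Real.norm_of_nonneg ht.1.le] at h2
      nlinarith [norm_nonneg u]
  have := hanti (Set.left_mem_Icc.2 zero_le_one) (Set.right_mem_Icc.2 zero_le_one) zero_le_one
  simp [φ] at this
  rw [hu, add_sub_cancel] at this
  linarith

theorem ConvexOn.sq_norm_gradient_sub_le {f : E → ℝ} {f' : E → E} {K : ℝ}
    (hf : ConvexOn ℝ Set.univ f) (hg : ∀ x, HasGradientAt f (f' x) x) (hK0 : 0 ≤ K)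
    (hK : ∀ x y, ‖f' x - f' y‖ ≤ K * ‖x - y‖) (x y : E) :
    ‖f' x - f' y‖ ^ 2 ≤ 2 * K * (f x - f y - ⟪f' y, x - y⟫) := by
  rcases hK0.eq_or_lt with rfl | hK0
  · have := hK x y
    rw [zero_mul] at this
    simp [le_antisymm this (norm_nonneg _)]
  set e := f' x - f' y with he
  have h1 := le_add_inner_add_sq_of_lipschitz_gradient hg hK x (x - K⁻¹ • e)
  have h2 := hf.add_inner_le_of_hasGradientAt (hg y) (x - K⁻¹ • e)
  have h3 : x - K⁻¹ • e - x = -(K⁻¹ • e) := by abel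
  have h4 : x - K⁻¹ • e - y = (x - y) - K⁻¹ • e := by abel
  rw [h3, inner_neg_right, norm_neg, norm_smul, inner_smul_right, mul_pow,
    Real.norm_of_nonneg (by positivity)] at h1
  rw [h4, inner_sub_right, inner_smul_right] at h2
  have h5 : ⟪f' x, e⟫ - ⟪f' y, e⟫ = ‖e‖ ^ 2 := by
    rw [← inner_sub_left, real_inner_self_eq_norm_sq]
  have h6 : K / 2 * (K⁻¹ ^ 2 * ‖e‖ ^ 2) = K⁻¹ * ‖e‖ ^ 2 / 2 := by field_simp
  have h7 : K⁻¹ * ⟪f' x, e⟫ - K⁻¹ * ⟪f' y, e⟫ = K⁻¹ * ‖e‖ ^ 2 := by rw [← mul_sub, h5]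
  have h8 : K⁻¹ * ‖e‖ ^ 2 / 2 ≤ f x - f y - ⟪f' y, x - y⟫ := by linarith
  calc ‖e‖ ^ 2 = 2 * K * (K⁻¹ * ‖e‖ ^ 2 / 2) := by field_simp
    _ ≤ _ := by gcongr

theorem ConvexOn.sq_norm_sub_le_of_strongly_convex {f : E → ℝ} {g x : E} {μ : ℝ}
    (hf : ConvexOn ℝ Set.univ (fun z => f z - μ / 2 * ‖z‖ ^ 2)) (hg : HasGradientAt f g x)
    (y : E) : μ / 2 * ‖y - x‖ ^ 2 ≤ f y - f x - ⟪g, y - x⟫ := by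
  have h1 : HasGradientAt (fun z : E => f z - μ / 2 * ‖z‖ ^ 2) (g - μ • x) x := by
    rw [hasGradientAt_iff_hasFDerivAt]
    have h2 := hg.hasFDerivAt.sub
      ((hasStrictFDerivAt_norm_sq x).hasFDerivAt.const_mul (μ / 2))
    have h3 : InnerProductSpace.toDual ℝ E (g - μ • x)
        = InnerProductSpace.toDual ℝ E g - (μ / 2) • 2 • innerSL ℝ x := by
      ext z
      simp
      ring
    rw [h3]
    exact h2
  have h2 := hf.add_inner_le_of_hasGradientAt h1 y
  have h3 : ‖y‖ ^ 2 = ‖x‖ ^ 2 + 2 * ⟪x, y - x⟫ + ‖y - x‖ ^ 2 := by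
    rw [← norm_add_sq_real, add_sub_cancel]
  rw [inner_sub_left, inner_smul_left] at h2
  simp only [h3, conj_trivial] at h2
  linarith

end Convex

section Sampling

open Finset

variable {ι : Type*} [Fintype ι] [DecidableEq ι] {b : ℕ}

theorem sum_subtype_card_eq_ite_subset (J : Finset ι) (hb : J.card ≤ b) :
    ∑ I : {I : Finset ι // I.card = b}, (if J ⊆ I.1 then 1 else 0 : ℝ)
      = (Fintype.card ι - J.card).choose (b - J.card) := by
  have h : ∀ I : Finset ι, I ∈ powersetCard b univ ↔ I.card = b := fun I => by
    simp [mem_powersetCard]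
  rw [← card_univ, ← card_filter_powersetCard_subset J univ b (subset_univ _) hb, card_filter,
    Nat.cast_sum, ← sum_subtype _ h (fun I => if J ⊆ I then (1 : ℝ) else 0)]
  simp

theorem card_mul_sum_ite_mem (hb : 1 ≤ b) (hbn : b ≤ Fintype.card ι) (i : ι) :
    (Fintype.card ι : ℝ) * ∑ I : {I : Finset ι // I.card = b}, (if i ∈ I.1 then 1 else 0 : ℝ)
      = b * Fintype.card {I : Finset ι // I.card = b} := by
  have h := sum_subtype_card_eq_ite_subset (b := b) {i} (by simpa using hb)
  simp only [singleton_subset_iff, card_singleton] at h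
  rw [h, Fintype.card_finset_len]
  obtain ⟨k, hk⟩ : ∃ k, b = k + 1 := ⟨b - 1, by omega⟩
  obtain ⟨l, hl⟩ : ∃ l, Fintype.card ι = l + 1 := ⟨Fintype.card ι - 1, by omega⟩
  rw [hk, hl]
  have := Nat.add_one_mul_choose_eq l k
  simp only [Nat.add_sub_cancel]
  rw [mul_comm ((k + 1 : ℕ) : ℝ)]
  exact_mod_cast this

theorem card_mul_sum_ite_mem_mul_ite_mem (hb : 1 ≤ b) (hbn : b ≤ Fintype.card ι) {i j : ι}
    (hij : i ≠ j) :
    (Fintype.card ι : ℝ) * (Fintype.card ι - 1) * ∑ I : {I : Finset ι // I.card = b},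
        ((if i ∈ I.1 then 1 else 0) * (if j ∈ I.1 then 1 else 0) : ℝ)
      = b * (b - 1) * Fintype.card {I : Finset ι // I.card = b} := by
  rcases hb.eq_or_lt with rfl | hb
  · rw [Fintype.sum_eq_zero]
    · simp
    · rintro ⟨I, hI⟩
      obtain ⟨a, rfl⟩ := card_eq_one.1 hI
      by_cases hi : i = a <;> by_cases hj : j = a <;> simp_all
  have h := sum_subtype_card_eq_ite_subset (b := b) {i, j} (by rw [card_pair hij]; omega)
  have h2 : ∀ I : {I : Finset ι // I.card = b},
      ((if i ∈ I.1 then 1 else 0) * (if j ∈ I.1 then 1 else 0) : ℝ)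
        = if {i, j} ⊆ I.1 then 1 else 0 := by
    intro I
    by_cases hi : i ∈ I.1 <;> by_cases hj : j ∈ I.1 <;> simp [hi, hj, insert_subset_iff]
  rw [sum_congr rfl fun I _ => h2 I, h, card_pair hij, Fintype.card_finset_len]
  obtain ⟨k, hk⟩ : ∃ k, b = k + 2 := ⟨b - 2, by omega⟩
  obtain ⟨l, hl⟩ : ∃ l, Fintype.card ι = l + 2 := ⟨Fintype.card ι - 2, by omega⟩
  rw [hk, hl]
  have h3 := Nat.add_one_mul_choose_eq (l + 1) (k + 1)
  have h4 := Nat.add_one_mul_choose_eq l k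
  simp only [Nat.add_sub_cancel]
  have h3' : ((l : ℝ) + 2) * ((l + 1).choose (k + 1) : ℝ) = (l + 2).choose (k + 2) * (k + 2) := by
    have : ((l + 1 + 1 : ℕ) : ℝ) * ((l + 1).choose (k + 1) : ℝ)
      = (l + 1 + 1).choose (k + 1 + 1) * (k + 1 + 1 : ℕ) := by exact_mod_cast h3
    push_cast at this
    convert this using 2 <;> ring
  have h4' : ((l : ℝ) + 1) * (l.choose k : ℝ) = (l + 1).choose (k + 1) * (k + 1) := by
    exact_mod_cast h4
  push_cast
  linear_combination ((l : ℝ) + 2) * h4' + (k + 1) * h3'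

variable {E : Type*} [NormedAddCommGroup E] [InnerProductSpace ℝ E]

theorem sum_mem_eq_sum_ite_smul (I : Finset ι) (c : ι → E) :
    ∑ i ∈ I, c i = ∑ i, (if i ∈ I then 1 else 0 : ℝ) • c i := by
  simp [ite_smul, sum_ite_mem]

theorem sum_sampled_mean_eq_zero (hb : 1 ≤ b) (hbn : b ≤ Fintype.card ι) {c : ι → E}
    (hc : ∑ i, c i = 0) :
    ∑ I : {I : Finset ι // I.card = b}, (b : ℝ)⁻¹ • ∑ i ∈ I.1, c i = 0 := by
  rw [sum_congr rfl fun I _ => by rw [sum_mem_eq_sum_ite_smul I.1 c]]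
  rw [← smul_sum, sum_comm]
  simp only [← sum_smul]
  have hn : (Fintype.card ι : ℝ) ≠ 0 := by
    have : 0 < Fintype.card ι := by omega
    positivity
  rw [sum_congr rfl fun i _ => by
      rw [eq_div_of_mul_eq hn ((mul_comm _ _).trans (card_mul_sum_ite_mem hb hbn i))],
    ← smul_sum, hc, smul_zero, smul_zero]

theorem sum_sq_norm_sampled_mean (hb : 1 ≤ b) (hbn : b ≤ Fintype.card ι)
    (hn : 2 ≤ Fintype.card ι) {c : ι → E} (hc : ∑ i, c i = 0) :
    ∑ I : {I : Finset ι // I.card = b}, ‖(b : ℝ)⁻¹ • ∑ i ∈ I.1, c i‖ ^ 2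
      = Fintype.card {I : Finset ι // I.card = b}
        * ((((Fintype.card ι : ℝ) - b) / (b * ((Fintype.card ι : ℝ) - 1)))
          * ((Fintype.card ι : ℝ)⁻¹ * ∑ i, ‖c i‖ ^ 2)) := by
  have hn2 : (2 : ℝ) ≤ Fintype.card ι := by exact_mod_cast hn
  have hb0 : (0 : ℝ) < b := by exact_mod_cast hb
  set n : ℝ := (Fintype.card ι : ℝ) with hndef
  set T : ℝ := (Fintype.card {I : Finset ι // I.card = b} : ℝ) with hT
  have hn0 : n ≠ 0 := by positivity
  have hn1 : n - 1 ≠ 0 := by intro h; linarith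
  have hpair : ∀ i j, ∑ I : {I : Finset ι // I.card = b},
      ((if i ∈ I.1 then 1 else 0) * (if j ∈ I.1 then 1 else 0) : ℝ)
        = b * (b - 1) * T / (n * (n - 1))
          + if i = j then b * T / n - b * (b - 1) * T / (n * (n - 1)) else 0 := by
    intro i j
    by_cases hij : i = j
    · subst hij
      have := card_mul_sum_ite_mem hb hbn i
      simp only [if_true, add_sub_cancel]
      rw [eq_div_iff hn0, ← this, mul_comm]
      congr 1
      exact sum_congr rfl fun I _ => by split_ifs <;> simp
    · have := card_mul_sum_ite_mem_mul_ite_mem hb hbn hij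
      simp only [if_neg hij, add_zero]
      rw [eq_div_iff (mul_ne_zero hn0 hn1), ← this, mul_comm]
  have hexp : ∀ I : {I : Finset ι // I.card = b}, ‖(b : ℝ)⁻¹ • ∑ i ∈ I.1, c i‖ ^ 2
      = (b : ℝ)⁻¹ ^ 2 * ∑ i, ∑ j, ((if i ∈ I.1 then 1 else 0) * (if j ∈ I.1 then 1 else 0) : ℝ)
        * ⟪c i, c j⟫ := by
    intro I
    rw [norm_smul, mul_pow, Real.norm_of_nonneg (by positivity), sum_mem_eq_sum_ite_smul,
      ← real_inner_self_eq_norm_sq, sum_inner]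
    simp only [inner_sum, real_inner_smul_left, real_inner_smul_right]
    congr 1
    exact sum_congr rfl fun i _ => sum_congr rfl fun j _ => by ring
  rw [sum_congr rfl fun I _ => hexp I, ← mul_sum, sum_comm]
  have h1 : ∀ i, ∑ I : {I : Finset ι // I.card = b}, ∑ j,
      ((if i ∈ I.1 then 1 else 0) * (if j ∈ I.1 then 1 else 0) : ℝ) * ⟪c i, c j⟫
        = (b * T / n - b * (b - 1) * T / (n * (n - 1))) * ‖c i‖ ^ 2 := by
    intro i
    rw [sum_comm]
    simp only [← sum_mul, hpair]
    simp only [add_mul, ite_mul, zero_mul, sum_add_distrib, ← mul_sum, ← inner_sum, hc,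
      inner_zero_right, mul_zero, zero_add, sum_ite_eq, mem_univ, if_true,
      real_inner_self_eq_norm_sq]
  rw [sum_congr rfl fun i _ => h1 i, ← mul_sum]
  field_simp
  ring

end Sampling

section Averages

theorem neg_sum_inner_le_of_norm_sub_le {E ι : Type*} [NormedAddCommGroup E]
    [InnerProductSpace ℝ E] [Fintype ι] {D z : ι → E} {γ : ℝ} (hD : ∑ i, D i = 0)
    (hz : ∀ i j, ‖z i - z j‖ ≤ γ * ‖D i - D j‖) :
    -∑ i, ⟪D i, z i⟫ ≤ γ * ∑ i, ‖D i‖ ^ 2 := by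
  rcases isEmpty_or_nonempty ι with hι | hι
  · simp
  have hc : (0 : ℝ) < Fintype.card ι := by exact_mod_cast Fintype.card_pos
  have h1 : ∑ i, ∑ j, ⟪D i - D j, z i - z j⟫ = 2 * Fintype.card ι * ∑ i, ⟪D i, z i⟫ := by
    simp only [inner_sub_left, inner_sub_right, Finset.sum_sub_distrib, Finset.sum_const,
      Finset.card_univ, ← inner_sum, ← sum_inner, hD, inner_zero_left, nsmul_eq_mul,
      ← Finset.mul_sum]
    ring
  have h2 : ∑ i, ∑ j, ‖D i - D j‖ ^ 2 = 2 * Fintype.card ι * ∑ i, ‖D i‖ ^ 2 := by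
    simp only [norm_sub_sq_real, Finset.sum_sub_distrib, Finset.sum_add_distrib, Finset.sum_const,
      Finset.card_univ, ← inner_sum, ← Finset.mul_sum, hD, inner_zero_right, nsmul_eq_mul]
    ring
  have h3 : -∑ i, ∑ j, ⟪D i - D j, z i - z j⟫ ≤ γ * ∑ i, ∑ j, ‖D i - D j‖ ^ 2 := by
    simp only [← Finset.sum_neg_distrib, Finset.mul_sum]
    refine Finset.sum_le_sum fun i _ => Finset.sum_le_sum fun j _ => ?_
    calc -⟪D i - D j, z i - z j⟫ ≤ ‖D i - D j‖ * ‖z i - z j‖ :=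
          (neg_le_abs _).trans (abs_real_inner_le_norm _ _)
      _ ≤ ‖D i - D j‖ * (γ * ‖D i - D j‖) := by gcongr; exact hz i j
      _ = γ * ‖D i - D j‖ ^ 2 := by ring
  rw [h1, h2] at h3
  have : 2 * Fintype.card ι * -∑ i, ⟪D i, z i⟫
      ≤ 2 * Fintype.card ι * (γ * ∑ i, ‖D i‖ ^ 2) := by linarith
  exact le_of_mul_le_mul_left this (by positivity)

theorem sum_le_sum_of_forall_sum_update_le {ι κ A : Type*} [Fintype ι] [Fintype κ] [Fintype A]
    [DecidableEq ι] [DecidableEq κ] [Nonempty A] (G K : (ι → κ → A) → ℝ) (s : ι) (k : κ)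
    (H : ∀ ω, ∑ a, G (Function.update ω s (Function.update (ω s) k a))
      ≤ ∑ a, K (Function.update ω s (Function.update (ω s) k a))) :
    ∑ ω, G ω ≤ ∑ ω, K ω := by
  let e : ((ι → κ → A) × A) → ((ι → κ → A) × A) := fun p =>
    (Function.update p.1 s (Function.update (p.1 s) k p.2), p.1 s k)
  have he : Function.Involutive e := by
    rintro ⟨ω, a⟩
    simp [e]
  have key : ∀ Q : (ι → κ → A) → ℝ,
      ∑ ω, ∑ a, Q (Function.update ω s (Function.update (ω s) k a))
        = Fintype.card A * ∑ ω, Q ω := by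
    intro Q
    have h1 := he.toPerm.sum_comp Finset.univ (fun p => Q p.1) (by simp)
    rw [Fintype.sum_prod_type, Fintype.sum_prod_type] at h1
    simp only [Function.Involutive.coe_toPerm, e] at h1
    rw [h1]
    simp [Finset.mul_sum]
  have h2 := Finset.sum_le_sum fun ω (_ : ω ∈ Finset.univ) => H ω
  rw [key, key] at h2
  exact le_of_mul_le_mul_left h2 (by exact_mod_cast Fintype.card_pos)

end Averages

section Step

theorem ConvexOn.add_inner_le_of_isMin_add_sq {F : Type*} [NormedAddCommGroup F]
    [InnerProductSpace ℝ F] {S : Set F} {h : F → ℝ} {c : ℝ} (hc : 0 < c) (hh : ConvexOn ℝ S h) {v w : F} (hv : v ∈ S)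
    (hmin : ∀ u ∈ S, 1 / c * h v + 1 / 2 * ‖v - w‖ ^ 2 ≤ 1 / c * h u + 1 / 2 * ‖u - w‖ ^ 2)
    {u : F} (hu : u ∈ S) : h v + ⟪c • (w - v), u - v⟫ ≤ h u := by
  have key : 0 ≤ 1 / c * (h u - h v) - ⟪w - v, u - v⟫ := by
    refine nonneg_of_forall_nonneg_add_mul (c := ‖u - v‖ ^ 2 / 2) fun t ht0 ht1 => ?_
    have hmem : (1 - t) • v + t • u ∈ S := hh.1 hv hu (by linarith) ht0.le (by ring)
    have h1 := hmin _ hmem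
    have h2 := hh.2 hv hu (by linarith : 0 ≤ 1 - t) ht0.le (by ring)
    have h3 : (1 - t) • v + t • u - w = t • (u - v) - (w - v) := by module
    rw [h3, norm_sub_rev v w, norm_sub_sq_real (t • (u - v)), norm_smul,
      Real.norm_of_nonneg ht0.le, real_inner_smul_left, real_inner_comm (w - v) (u - v)] at h1
    have h5 := mul_le_mul_of_nonneg_left h2 (by positivity : 0 ≤ 1 / c)
    simp only [smul_eq_mul] at h5
    have h6 : 0 ≤ t * (1 / c * (h u - h v) - ⟪w - v, u - v⟫ + t * (‖u - v‖ ^ 2 / 2)) := by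
      linarith
    exact nonneg_of_mul_nonneg_right h6 ht0
  rw [real_inner_smul_left]
  have h7 := mul_nonneg hc.le key
  have h8 : c * (1 / c * (h u - h v)) = h u - h v := by field_simp
  rw [mul_sub, h8] at h7
  linarith

variable {E F : Type*} [NormedAddCommGroup E] [InnerProductSpace ℝ E] [CompleteSpace E]
  [NormedAddCommGroup F] [InnerProductSpace ℝ F] [CompleteSpace F]

/-- One primal-dual step from `x` along the gradient estimate `g`: the new dual point is
characterised by the first-order optimality condition `B x₁ ∈ ∂h(v₁)` over `S`. -/
structure IsPrimalDualStep (B : E →L[ℝ] F) (S : Set F) (h : F → ℝ) (γ : ℝ) (x g x₁ : E)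
    (v₁ : F) : Prop where
  mem : v₁ ∈ S
  eq : x₁ = x - γ • g - γ • ContinuousLinearMap.adjoint B v₁
  le : ∀ u ∈ S, h v₁ + ⟪B x₁, u - v₁⟫ ≤ h u

variable {B : E →L[ℝ] F} {S : Set F} {h : F → ℝ} {γ : ℝ}

theorem IsPrimalDualStep.of_isMin (hB : ∀ u, B (ContinuousLinearMap.adjoint B u) = u)
    (hγ : 0 < γ) (hh : ConvexOn ℝ S h) {x g y x₁ : E} {v v₁ : F} (hmem : v₁ ∈ S)
    (hy : y = x - γ • g - γ • ContinuousLinearMap.adjoint B v)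
    (hx : x₁ = x - γ • g - γ • ContinuousLinearMap.adjoint B v₁)
    (hmin : ∀ u ∈ S, 1 / γ * h v₁ + 1 / 2 * ‖v₁ - ((1 / γ) • B y + v)‖ ^ 2
      ≤ 1 / γ * h u + 1 / 2 * ‖u - ((1 / γ) • B y + v)‖ ^ 2) :
    IsPrimalDualStep B S h γ x g x₁ v₁ := by
  refine ⟨hmem, hx, fun u hu => ?_⟩
  have h1 := hh.add_inner_le_of_isMin_add_sq hγ hmem hmin hu
  have h2 : γ • ((1 / γ) • B y + v - v₁) = B x₁ := by
    rw [hy, hx, smul_sub, smul_add, smul_smul, mul_one_div_cancel hγ.ne', one_smul]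
    simp only [map_sub, map_smul, hB]
    abel
  rwa [h2] at h1

theorem IsPrimalDualStep.norm_sub_le (hγ : 0 ≤ γ) {x g g' x₁ x₂ : E} {v₁ v₂ : F}
    (h₁ : IsPrimalDualStep B S h γ x g x₁ v₁) (h₂ : IsPrimalDualStep B S h γ x g' x₂ v₂) :
    ‖x₁ - x₂‖ ≤ γ * ‖g - g'‖ := by
  have ha := h₁.le _ h₂.mem
  have hb := h₂.le _ h₁.mem
  have hab : 0 ≤ ⟪B (x₁ - x₂), v₁ - v₂⟫ := by
    rw [← neg_sub v₁ v₂, inner_neg_right] at ha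
    rw [map_sub, inner_sub_left]
    linarith
  have hd : x₁ - x₂ = -(γ • (g - g')) - γ • ContinuousLinearMap.adjoint B (v₁ - v₂) := by
    rw [h₁.eq, h₂.eq, map_sub]; module
  have hsq : ‖x₁ - x₂‖ ^ 2 = -γ * ⟪x₁ - x₂, g - g'⟫ - γ * ⟪B (x₁ - x₂), v₁ - v₂⟫ := by
    rw [← real_inner_self_eq_norm_sq]
    nth_rw 2 [hd]
    rw [inner_sub_right, inner_neg_right, real_inner_smul_right, real_inner_smul_right,
      ContinuousLinearMap.adjoint_inner_right]
    ring
  have hcs : -⟪x₁ - x₂, g - g'⟫ ≤ ‖x₁ - x₂‖ * ‖g - g'‖ :=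
    (neg_le_abs _).trans (abs_real_inner_le_norm _ _)
  have hle : ‖x₁ - x₂‖ ^ 2 ≤ γ * (‖x₁ - x₂‖ * ‖g - g'‖) := by
    nlinarith [mul_nonneg hγ hab, mul_le_mul_of_nonneg_left hcs hγ]
  rcases (norm_nonneg (x₁ - x₂)).eq_or_lt with h0 | h0
  · rw [← h0]; positivity
  · refine le_of_mul_le_mul_left ?_ h0
    calc _ = ‖x₁ - x₂‖ ^ 2 := by ring
      _ ≤ _ := hle
      _ = _ := by ring

theorem IsPrimalDualStep.descent {φ : E → ℝ} {φ' : E → E} {K : ℝ} (hγ : 0 < γ) (hγK : γ * K ≤ 1)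
    (hφ : ConvexOn ℝ Set.univ φ) (hφ' : ∀ x, HasGradientAt φ (φ' x) x)
    (hK : ∀ x y, ‖φ' x - φ' y‖ ≤ K * ‖x - y‖) {xs : E} {vs : F} (hvs : vs ∈ S)
    (hopt : φ' xs + ContinuousLinearMap.adjoint B vs = 0) {x g x₁ : E} {v₁ : F}
    (hstep : IsPrimalDualStep B S h γ x g x₁ v₁) :
    2 * γ * ((φ x₁ - φ xs - ⟪φ' xs, x₁ - xs⟫) + (h v₁ - h vs - ⟪B xs, v₁ - vs⟫))
        + ‖x₁ - xs‖ ^ 2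
      ≤ ‖x - xs‖ ^ 2 - 2 * γ * ⟪g - φ' x, x₁ - xs⟫ := by
  have h1 := le_add_inner_add_sq_of_lipschitz_gradient hφ' hK x x₁
  have h2 := hφ.add_inner_le_of_hasGradientAt (hφ' x) xs
  have h3 := hstep.le _ hvs
  have h4 : ‖x - xs‖ ^ 2 = ‖x₁ - xs‖ ^ 2 + 2 * ⟪x - x₁, x₁ - xs⟫ + ‖x₁ - x‖ ^ 2 := by
    rw [norm_sub_rev x₁ x, show x - xs = (x₁ - xs) + (x - x₁) by abel, norm_add_sq_real,
      real_inner_comm]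
  have h5 : x - x₁ = γ • (g + ContinuousLinearMap.adjoint B v₁) := by
    rw [hstep.eq]; module
  have h6 : ⟪ContinuousLinearMap.adjoint B v₁, x₁ - xs⟫
      = ⟪B x₁, v₁ - vs⟫ - ⟪B xs, v₁ - vs⟫ - ⟪φ' xs, x₁ - xs⟫ := by
    rw [eq_neg_of_add_eq_zero_left hopt, inner_neg_left, ContinuousLinearMap.adjoint_inner_left,
      ContinuousLinearMap.adjoint_inner_left, map_sub]
    simp only [inner_sub_right, real_inner_comm]
    ring
  rw [h5, real_inner_smul_left, inner_add_left, h6] at h4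
  have h7 : ⟪B x₁, vs - v₁⟫ = -⟪B x₁, v₁ - vs⟫ := by rw [← inner_neg_right, neg_sub]
  have h8 : ⟪φ' x, x₁ - x⟫ - ⟪φ' x, xs - x⟫ = ⟪φ' x, x₁ - xs⟫ := by
    rw [← inner_sub_right]; congr 1; abel
  rw [inner_sub_left]
  have h9 : φ x₁ - φ xs - K / 2 * ‖x₁ - x‖ ^ 2 ≤ ⟪φ' x, x₁ - xs⟫ := by linarith
  have h10 := mul_le_mul_of_nonneg_left h9 hγ.le
  have h11 := mul_le_mul_of_nonneg_right hγK (sq_nonneg ‖x₁ - x‖)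
  rw [h7] at h3
  have h12 := mul_le_mul_of_nonneg_left h3 hγ.le
  linarith

end Step

section Adapted

theorem eq_of_agree_before {N m : ℕ} {A E : Type*} {T : (Fin N → Fin m → A) → ℕ → E}
    {X : (Fin N → Fin m → A) → ℕ → ℕ → E} (hT0 : ∀ ω ω', T ω 0 = T ω' 0)
    (hX0 : ∀ ω, ∀ s : Fin N, X ω s 0 = T ω s)
    (hX : ∀ ω ω', ∀ s : Fin N, ∀ k : Fin m, ω s k = ω' s k → T ω s = T ω' s →
      X ω s k = X ω' s k → X ω s (k + 1) = X ω' s (k + 1))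
    (hT : ∀ ω ω', ∀ s : Fin N, (∀ k < m, X ω s (k + 1) = X ω' s (k + 1)) →
      T ω (s + 1) = T ω' (s + 1))
    {ω ω' : Fin N → Fin m → A} {s : Fin N} {k : Fin m} (hs : ∀ s' < s, ω s' = ω' s')
    (hk : ∀ j < k, ω s j = ω' s j) : T ω s = T ω' s ∧ X ω s k = X ω' s k := by
  have inner : ∀ (t : Fin N) (l : ℕ), l ≤ m → T ω t = T ω' t →
      (∀ j : Fin m, (j : ℕ) < l → ω t j = ω' t j) → X ω t l = X ω' t l := by
    intro t l
    induction l with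
    | zero => intro _ h _; rw [hX0, hX0, h]
    | succ l ih =>
      intro hl h hj
      exact hX ω ω' t ⟨l, hl⟩ (hj _ (Nat.lt_succ_self l)) h
        (ih (by omega) h fun j hjl => hj j (by omega))
  have outer : ∀ t : ℕ, t ≤ s → T ω t = T ω' t := by
    intro t
    induction t with
    | zero => intro _; exact hT0 ω ω'
    | succ t ih =>
      intro ht
      have htN : t < N := by have := s.2; omega
      refine hT ω ω' ⟨t, htN⟩ fun l hl => ?_
      refine inner ⟨t, htN⟩ (l + 1) hl (ih (by omega)) fun j _ => ?_
      rw [hs ⟨t, htN⟩ (Fin.lt_def.2 ht)]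
  exact ⟨outer s le_rfl, inner s k k.2.le (outer s le_rfl) fun j hj => hk j (Fin.lt_def.2 hj)⟩

end Adapted

section Epoch

theorem sum_le_of_epoch_recursion {γ M μ κ : ℝ} {m : ℕ} (hγ : 0 < γ) (hM : 0 ≤ M)
    (hγM : γ * M < 1) (hμ : 0 < μ) (hm : 1 ≤ m)
    (hκ : κ = 1 / (μ * γ * (1 - γ * M) * m) + ((m : ℝ) + 1) * γ * M / ((1 - γ * M) * m))
    {e d r : ℕ → ℝ} (he : ∀ k, 0 ≤ e k) (hd : ∀ k, 0 ≤ d k) (he0 : μ / 2 * e 0 ≤ d 0)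
    (hdr : ∀ k < m, d (k + 1) ≤ r (k + 1))
    (hrec : ∀ k < m, 2 * γ * r (k + 1) + e (k + 1) ≤ e k + 2 * γ ^ 2 * M * (d k + d 0)) :
    (m : ℝ)⁻¹ * ∑ k ∈ Finset.range m, r (k + 1) ≤ κ * d 0 := by
  have hpos : 0 < 1 - γ * M := by linarith
  have hm0 : (0 : ℝ) < m := by exact_mod_cast hm
  have hgM : 0 ≤ 2 * γ ^ 2 * M := by positivity
  have key : ∀ j ≤ m, e j + 2 * γ * (1 - γ * M) * ∑ k ∈ Finset.range j, r (k + 1)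
      + 2 * γ ^ 2 * M * d j ≤ e 0 + 2 * γ ^ 2 * M * (j + 1) * d 0 := by
    intro j
    induction j with
    | zero => intro _; simp
    | succ j ih =>
      intro hj
      have h1 := ih (by omega)
      have h2 := hrec j hj
      have h3 := mul_le_mul_of_nonneg_left (hdr j hj) hgM
      rw [Finset.sum_range_succ]
      push_cast
      linarith
  have h1 := key m le_rfl
  have h2 : e 0 ≤ 2 / μ * d 0 := by
    rw [div_mul_eq_mul_div, le_div_iff₀ hμ]; linarith
  have h3 : 2 * γ * (1 - γ * M) * ∑ k ∈ Finset.range m, r (k + 1)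
      ≤ 2 / μ * d 0 + 2 * γ ^ 2 * M * (m + 1) * d 0 := by
    linarith [he m, mul_nonneg hgM (hd m)]
  rw [inv_mul_le_iff₀ hm0]
  refine le_of_mul_le_mul_left (h3.trans_eq ?_) (by positivity : 0 < 2 * γ * (1 - γ * M))
  rw [hκ]
  have := hpos.ne'
  field_simp

end Epoch

section FiniteSum

variable {E F : Type*} [NormedAddCommGroup E] [InnerProductSpace ℝ E] [CompleteSpace E]
  [NormedAddCommGroup F] [InnerProductSpace ℝ F] [CompleteSpace F] {n : ℕ}

theorem HasGradientAt.mean {f : Fin n → E → ℝ} {f' : Fin n → E} {x : E}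
    (hgrad : ∀ i, HasGradientAt (f i) (f' i) x) :
    HasGradientAt (fun z => (n : ℝ)⁻¹ * ∑ i, f i z) ((n : ℝ)⁻¹ • ∑ i, f' i) x := by
  rw [hasGradientAt_iff_hasFDerivAt, map_smul, map_sum]
  exact (HasFDerivAt.fun_sum fun i _ => (hgrad i).hasFDerivAt).const_mul _

theorem ConvexOn.mean {E : Type*} [NormedAddCommGroup E] [InnerProductSpace ℝ E]
    {f : Fin n → E → ℝ} (hconv : ∀ i, ConvexOn ℝ Set.univ (f i)) :
    ConvexOn ℝ Set.univ (fun z => (n : ℝ)⁻¹ * ∑ i, f i z) := by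
  refine ⟨convex_univ, fun x _ y _ p q hp hq hpq => ?_⟩
  calc (n : ℝ)⁻¹ * ∑ i, f i (p • x + q • y)
      ≤ (n : ℝ)⁻¹ * ∑ i, (p • f i x + q • f i y) := by
        gcongr with i
        exact (hconv i).2 trivial trivial hp hq hpq
    _ = _ := by
        simp only [smul_eq_mul, Finset.sum_add_distrib, ← Finset.mul_sum]
        ring

theorem sum_sq_norm_sub_mean_le {E : Type*} [NormedAddCommGroup E] [InnerProductSpace ℝ E]
    (c : Fin n → E) (hn : 1 ≤ n) :
    ∑ i, ‖c i - (n : ℝ)⁻¹ • ∑ j, c j‖ ^ 2 ≤ ∑ i, ‖c i‖ ^ 2 := by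
  have hn0 : (n : ℝ) ≠ 0 := by positivity
  set a := (n : ℝ)⁻¹ • ∑ j, c j with ha
  have hs : ∑ j, c j = (n : ℝ) • a := by rw [ha, smul_inv_smul₀ hn0]
  simp only [norm_sub_sq_real, Finset.sum_add_distrib, Finset.sum_sub_distrib, ← Finset.mul_sum,
    ← sum_inner, hs, real_inner_smul_left, real_inner_self_eq_norm_sq, Finset.sum_const,
    Finset.card_univ, Fintype.card_fin, nsmul_eq_mul]
  nlinarith [mul_nonneg (Nat.cast_nonneg (α := ℝ) n) (sq_nonneg ‖a‖)]

theorem svrg_error_eq {E : Type*} [AddCommGroup E] [Module ℝ E] (a c : Fin n → E) {b : ℕ}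
    (hb : 1 ≤ b) {I : Finset (Fin n)} (hI : I.card = b) :
    (b : ℝ)⁻¹ • ∑ i ∈ I, (a i - c i) + (n : ℝ)⁻¹ • ∑ i, c i - (n : ℝ)⁻¹ • ∑ i, a i
      = (b : ℝ)⁻¹ • ∑ i ∈ I, (a i - c i - (n : ℝ)⁻¹ • ∑ j, (a j - c j)) := by
  have hb0 : (b : ℝ) ≠ 0 := by positivity
  rw [Finset.sum_sub_distrib _ (fun _ => (n : ℝ)⁻¹ • ∑ j, (a j - c j)), Finset.sum_const, hI,
    smul_sub, ← Nat.cast_smul_eq_nsmul ℝ, inv_smul_smul₀ hb0, Finset.sum_sub_distrib a c,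
    Finset.sum_sub_distrib (s := Finset.univ) a c, smul_sub, smul_sub]
  abel

theorem sum_sub_mean_eq_zero {E : Type*} [AddCommGroup E] [Module ℝ E] (c : Fin n → E)
    (hn : 1 ≤ n) : ∑ i, (c i - (n : ℝ)⁻¹ • ∑ j, c j) = 0 := by
  have hn0 : (n : ℝ) ≠ 0 := by positivity
  rw [Finset.sum_sub_distrib, Finset.sum_const, Finset.card_univ, Fintype.card_fin,
    ← Nat.cast_smul_eq_nsmul ℝ, smul_inv_smul₀ hn0, sub_self]

theorem sum_svrg_error_eq_zero {E : Type*} [NormedAddCommGroup E] [InnerProductSpace ℝ E]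
    (a c : Fin n → E) {b : ℕ} (hb : 1 ≤ b) (hbn : b ≤ n) :
    ∑ I : {I : Finset (Fin n) // I.card = b},
        ((b : ℝ)⁻¹ • ∑ i ∈ I.1, (a i - c i) + (n : ℝ)⁻¹ • ∑ i, c i - (n : ℝ)⁻¹ • ∑ i, a i) = 0 := by
  rw [Finset.sum_congr rfl fun I _ => svrg_error_eq a c hb I.2]
  exact sum_sampled_mean_eq_zero hb (by simpa using hbn)
    (sum_sub_mean_eq_zero (fun i => a i - c i) (hb.trans hbn))

theorem sum_sq_norm_svrg_error_le {f : Fin n → E → ℝ} {f' : Fin n → E → E}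
    (hconv : ∀ i, ConvexOn ℝ Set.univ (f i)) (hgrad : ∀ i x, HasGradientAt (f i) (f' i x) x)
    {L : ℝ} (hL0 : 0 ≤ L) (hL : ∀ i x y, ‖f' i x - f' i y‖ ≤ L * ‖x - y‖) (hn : 2 ≤ n)
    {b : ℕ} (hb : 1 ≤ b) (hbn : b ≤ n) (x t xs : E) :
    ∑ I : {I : Finset (Fin n) // I.card = b},
        ‖(b : ℝ)⁻¹ • ∑ i ∈ I.1, (f' i x - f' i t) + (n : ℝ)⁻¹ • ∑ i, f' i t
          - (n : ℝ)⁻¹ • ∑ i, f' i x‖ ^ 2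
      ≤ Fintype.card {I : Finset (Fin n) // I.card = b} *
        (4 * L * (((n : ℝ) - b) / (b * ((n : ℝ) - 1))) *
        (((n : ℝ)⁻¹ * ∑ i, f i x - (n : ℝ)⁻¹ * ∑ i, f i xs
            - ⟪(n : ℝ)⁻¹ • ∑ i, f' i xs, x - xs⟫)
          + ((n : ℝ)⁻¹ * ∑ i, f i t - (n : ℝ)⁻¹ * ∑ i, f i xs
            - ⟪(n : ℝ)⁻¹ • ∑ i, f' i xs, t - xs⟫))) := by
  have hn2 : (2 : ℝ) ≤ n := by exact_mod_cast hn
  have hbn' : (b : ℝ) ≤ n := by exact_mod_cast hbn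
  have hb0 : (0 : ℝ) < b := by exact_mod_cast hb
  rw [Finset.sum_congr rfl fun I _ => by
      rw [svrg_error_eq (fun i => f' i x) (fun i => f' i t) hb I.2],
    sum_sq_norm_sampled_mean hb (by simpa using hbn) (by simpa using hn)
      (sum_sub_mean_eq_zero (fun i => f' i x - f' i t) (hb.trans hbn)), Fintype.card_fin]
  have hC : 0 ≤ ((n : ℝ) - b) / (b * ((n : ℝ) - 1)) :=
    div_nonneg (by linarith) (mul_nonneg hb0.le (by linarith))
  rw [mul_comm (4 * L), mul_assoc (((n : ℝ) - b) / (b * ((n : ℝ) - 1)))]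
  refine mul_le_mul_of_nonneg_left (mul_le_mul_of_nonneg_left ?_ hC) (Nat.cast_nonneg _)
  calc (n : ℝ)⁻¹ * ∑ i, ‖f' i x - f' i t - (n : ℝ)⁻¹ • ∑ j, (f' j x - f' j t)‖ ^ 2
      ≤ (n : ℝ)⁻¹ * ∑ i, ‖f' i x - f' i t‖ ^ 2 := by
        gcongr ?_ * ?_
        exact sum_sq_norm_sub_mean_le (fun i => f' i x - f' i t) (hb.trans hbn)
    _ ≤ (n : ℝ)⁻¹ * ∑ i, 4 * L * ((f i x - f i xs - ⟪f' i xs, x - xs⟫)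
          + (f i t - f i xs - ⟪f' i xs, t - xs⟫)) := by
        gcongr with i
        have h1 := (hconv i).sq_norm_gradient_sub_le (hgrad i) hL0 (hL i) x xs
        have h2 := (hconv i).sq_norm_gradient_sub_le (hgrad i) hL0 (hL i) t xs
        have h3 : ‖f' i x - f' i t‖ ≤ ‖f' i x - f' i xs‖ + ‖f' i t - f' i xs‖ := by
          rw [← sub_sub_sub_cancel_right _ _ (f' i xs)]
          exact norm_sub_le _ _
        nlinarith [sq_nonneg (‖f' i x - f' i xs‖ - ‖f' i t - f' i xs‖),
          norm_nonneg (f' i x - f' i t)]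
    _ = _ := by
        simp only [← Finset.mul_sum, Finset.sum_add_distrib, Finset.sum_sub_distrib,
          real_inner_smul_left, sum_inner]
        ring

/-- The expected descent inequality of SVRG-PDFP, summed over all mini-batches. -/
theorem sum_svrg_step_le {f : Fin n → E → ℝ} {f' : Fin n → E → E}
    (hconv : ∀ i, ConvexOn ℝ Set.univ (f i)) (hgrad : ∀ i x, HasGradientAt (f i) (f' i x) x)
    {L : ℝ} (hL0 : 0 ≤ L) (hL : ∀ i x y, ‖f' i x - f' i y‖ ≤ L * ‖x - y‖) (hn : 2 ≤ n)
    {b : ℕ} (hb : 1 ≤ b) (hbn : b ≤ n) {M : ℝ}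
    (hM : M = 4 * L * (((n : ℝ) - b) / (b * ((n : ℝ) - 1)))) {K γ : ℝ} (hγ : 0 < γ)
    (hγK : γ * K ≤ 1)
    (hK : ∀ x y, ‖((n : ℝ)⁻¹ • ∑ i, f' i x) - (n : ℝ)⁻¹ • ∑ i, f' i y‖ ≤ K * ‖x - y‖)
    {B : E →L[ℝ] F} {S : Set F} {h : F → ℝ} {xs : E} {vs : F} (hvs : vs ∈ S)
    (hopt : ((n : ℝ)⁻¹ • ∑ i, f' i xs) + ContinuousLinearMap.adjoint B vs = 0) {x t : E}
    {D : E → ℝ} (hD : ∀ z, D z = (n : ℝ)⁻¹ * ∑ i, f i z - (n : ℝ)⁻¹ * ∑ i, f i xs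
      - ⟪(n : ℝ)⁻¹ • ∑ i, f' i xs, z - xs⟫)
    {H : F → ℝ} (hH : ∀ u, H u = h u - h vs - ⟪B xs, u - vs⟫)
    {x₁ : {I : Finset (Fin n) // I.card = b} → E} {v₁ : {I : Finset (Fin n) // I.card = b} → F}
    (hstep : ∀ I, IsPrimalDualStep B S h γ x
      ((b : ℝ)⁻¹ • ∑ i ∈ I.1, (f' i x - f' i t) + (n : ℝ)⁻¹ • ∑ i, f' i t) (x₁ I) (v₁ I)) :
    ∑ I, (2 * γ * (D (x₁ I) + H (v₁ I)) + ‖x₁ I - xs‖ ^ 2)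
      ≤ ∑ _I : {I : Finset (Fin n) // I.card = b},
        (‖x - xs‖ ^ 2 + 2 * γ ^ 2 * M * (D x + D t)) := by
  set δ : {I : Finset (Fin n) // I.card = b} → E := fun I =>
    (b : ℝ)⁻¹ • ∑ i ∈ I.1, (f' i x - f' i t) + (n : ℝ)⁻¹ • ∑ i, f' i t
      - (n : ℝ)⁻¹ • ∑ i, f' i x with hδ
  have h1 : ∀ I, 2 * γ * (D (x₁ I) + H (v₁ I)) + ‖x₁ I - xs‖ ^ 2
      ≤ ‖x - xs‖ ^ 2 - 2 * γ * ⟪δ I, x₁ I - xs⟫ := by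
    intro I
    rw [hD, hH]
    exact (hstep I).descent hγ hγK (ConvexOn.mean hconv)
      (fun z => HasGradientAt.mean fun i => hgrad i z) hK hvs hopt
  have h2 : -∑ I, ⟪δ I, x₁ I - xs⟫ ≤ γ * ∑ I, ‖δ I‖ ^ 2 := by
    refine neg_sum_inner_le_of_norm_sub_le
      (sum_svrg_error_eq_zero (fun i => f' i x) (fun i => f' i t) hb hbn) fun I J => ?_
    rw [sub_sub_sub_cancel_right, show δ I - δ J = _ from sub_sub_sub_cancel_right _ _ _]
    exact (hstep I).norm_sub_le hγ.le (hstep J)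
  have h3 := sum_sq_norm_svrg_error_le hconv hgrad hL0 hL hn hb hbn x t xs
  rw [← hM, ← hD, ← hD] at h3
  change ∑ I, ‖δ I‖ ^ 2 ≤ _ at h3
  have h4 := mul_le_mul_of_nonneg_left h3 (by positivity : 0 ≤ 2 * γ ^ 2)
  have h5 := mul_le_mul_of_nonneg_left h2 (by positivity : 0 ≤ 2 * γ)
  refine (Finset.sum_le_sum fun I _ => h1 I).trans ?_
  simp only [Finset.sum_sub_distrib, Finset.sum_add_distrib, ← Finset.mul_sum, Finset.sum_const,
    Finset.card_univ, nsmul_eq_mul]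
  linarith

end FiniteSum

/-- linear convergence of Algorithm 1 (SVRG-PDFP) when `BBᵀ = I`,
with `λ = 1` and NO strong convexity assumption on `h`:
`E[R(x̃_s, ṽ_s)] ≤ κ^s R(x̃_0, ṽ_0)` for every `s ≥ 0` (here `N`), where
`κ = 1/(μ_f γ(1 − γM)m) + ((m + 1)γM)/((1 − γM)m)`.
The sample space is `Fin N → Fin m → {I : Finset (Fin n) // I.card = b}` and the
expectation is the plain average over it. The conjugate `h = g*` is modelled by a
real-valued function on its effective domain `S`; the prox (with `λ = 1`) is the
(unique) minimizer over `S`. Strong convexity of `f` with modulus `μ_f` means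
convexity of `f − (μ_f/2)‖·‖²`. -/
theorem stmt_11 {d r n : ℕ} (hn : 2 ≤ n)
    (f : Fin n → EuclideanSpace ℝ (Fin d) → ℝ)
    (f' : Fin n → EuclideanSpace ℝ (Fin d) → EuclideanSpace ℝ (Fin d))
    (hconv : ∀ i, ConvexOn ℝ Set.univ (f i))
    (hgrad : ∀ i x, HasGradientAt (f i) (f' i x) x)
    (L : Fin n → ℝ)
    (hLip : ∀ i x y, ‖f' i x - f' i y‖ ≤ L i * ‖x - y‖)
    (Lmax : ℝ) (hLmax : IsGreatest (Set.range L) Lmax)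
    (β : ℝ) (hβ0 : 0 < β)
    (hfLip : ∀ x y,
      ‖((n : ℝ)⁻¹ • ∑ i, f' i x) - (n : ℝ)⁻¹ • ∑ i, f' i y‖ ≤ (1 / β) * ‖x - y‖)
    (μf : ℝ) (hμf : 0 < μf)
    (hstrongf : ConvexOn ℝ Set.univ
      (fun z : EuclideanSpace ℝ (Fin d) => ((n : ℝ)⁻¹ * ∑ i, f i z) - μf / 2 * ‖z‖ ^ 2))
    (B : EuclideanSpace ℝ (Fin d) →L[ℝ] EuclideanSpace ℝ (Fin r))
    (hBBt : ∀ u : EuclideanSpace ℝ (Fin r), B (ContinuousLinearMap.adjoint B u) = u)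
    (S : Set (EuclideanSpace ℝ (Fin r)))
    (h : EuclideanSpace ℝ (Fin r) → ℝ)
    (hS : S.Nonempty) (hhconv : ConvexOn ℝ S h)
    (hlsc : LowerSemicontinuousOn h S)
    (γ : ℝ) (hγ0 : 0 < γ) (hγβ : γ ≤ β)
    (b : ℕ) (hb1 : 1 ≤ b) (hbn : b ≤ n)
    (m : ℕ) (hm : 1 ≤ m)
    (M : ℝ) (hM : M = 4 * Lmax * (((n : ℝ) - b) / (b * ((n : ℝ) - 1))))
    (hγM : γ * M < 1)
    (κ : ℝ)
    (hκ : κ = 1 / (μf * γ * (1 - γ * M) * m)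
            + ((m : ℝ) + 1) * γ * M / ((1 - γ * M) * m))
    (xstar : EuclideanSpace ℝ (Fin d)) (vstar : EuclideanSpace ℝ (Fin r))
    (hvstar : vstar ∈ S)
    (hopt1 : ((n : ℝ)⁻¹ • ∑ i, f' i xstar) + ContinuousLinearMap.adjoint B vstar = 0)
    (hopt2 : ∀ u ∈ S, h u - h vstar - ⟪B xstar, u - vstar⟫ ≥ 0)
    (xt0 : EuclideanSpace ℝ (Fin d)) (vt0 : EuclideanSpace ℝ (Fin r)) (hvt0 : vt0 ∈ S)
    (N : ℕ)
    (tilx : (Fin N → Fin m → {I : Finset (Fin n) // I.card = b}) → ℕ →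
      EuclideanSpace ℝ (Fin d))
    (tilv : (Fin N → Fin m → {I : Finset (Fin n) // I.card = b}) → ℕ →
      EuclideanSpace ℝ (Fin r))
    (x : (Fin N → Fin m → {I : Finset (Fin n) // I.card = b}) → ℕ → ℕ →
      EuclideanSpace ℝ (Fin d))
    (y : (Fin N → Fin m → {I : Finset (Fin n) // I.card = b}) → ℕ → ℕ →
      EuclideanSpace ℝ (Fin d))
    (v : (Fin N → Fin m → {I : Finset (Fin n) // I.card = b}) → ℕ → ℕ →
      EuclideanSpace ℝ (Fin r))
    (htilx0 : ∀ ω, tilx ω 0 = xt0) (htilv0 : ∀ ω, tilv ω 0 = vt0)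
    (hx0 : ∀ ω, ∀ s : Fin N, x ω (s : ℕ) 0 = tilx ω (s : ℕ))
    (hv0 : ∀ ω, ∀ s : Fin N, v ω (s : ℕ) 0 = tilv ω (s : ℕ))
    (hy : ∀ ω, ∀ s : Fin N, ∀ k : Fin m,
      y ω (s : ℕ) ((k : ℕ) + 1)
        = x ω (s : ℕ) (k : ℕ)
          - γ • (((b : ℝ)⁻¹ • ∑ i ∈ (ω s k).1,
                (f' i (x ω (s : ℕ) (k : ℕ)) - f' i (tilx ω (s : ℕ))))
              + (n : ℝ)⁻¹ • ∑ i, f' i (tilx ω (s : ℕ)))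
          - γ • ContinuousLinearMap.adjoint B (v ω (s : ℕ) (k : ℕ)))
    (hvmem : ∀ ω, ∀ s : Fin N, ∀ k : Fin m, v ω (s : ℕ) ((k : ℕ) + 1) ∈ S)
    (hvmin : ∀ ω, ∀ s : Fin N, ∀ k : Fin m, ∀ u ∈ S,
      (1 / γ) * h (v ω (s : ℕ) ((k : ℕ) + 1))
          + (1 / 2) * ‖v ω (s : ℕ) ((k : ℕ) + 1)
              - ((1 / γ) • B (y ω (s : ℕ) ((k : ℕ) + 1)) + v ω (s : ℕ) (k : ℕ))‖ ^ 2
        ≤ (1 / γ) * h u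
          + (1 / 2) * ‖u
              - ((1 / γ) • B (y ω (s : ℕ) ((k : ℕ) + 1)) + v ω (s : ℕ) (k : ℕ))‖ ^ 2)
    (hx : ∀ ω, ∀ s : Fin N, ∀ k : Fin m,
      x ω (s : ℕ) ((k : ℕ) + 1)
        = x ω (s : ℕ) (k : ℕ)
          - γ • (((b : ℝ)⁻¹ • ∑ i ∈ (ω s k).1,
                (f' i (x ω (s : ℕ) (k : ℕ)) - f' i (tilx ω (s : ℕ))))
              + (n : ℝ)⁻¹ • ∑ i, f' i (tilx ω (s : ℕ)))
          - γ • ContinuousLinearMap.adjoint B (v ω (s : ℕ) ((k : ℕ) + 1)))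
    (htilx : ∀ ω, ∀ s : Fin N,
      tilx ω ((s : ℕ) + 1) = (m : ℝ)⁻¹ • ∑ k ∈ Finset.range m, x ω (s : ℕ) (k + 1))
    (htilv : ∀ ω, ∀ s : Fin N,
      tilv ω ((s : ℕ) + 1) = (m : ℝ)⁻¹ • ∑ k ∈ Finset.range m, v ω (s : ℕ) (k + 1)) :
    (∑ ω : Fin N → Fin m → {I : Finset (Fin n) // I.card = b},
        ((((n : ℝ)⁻¹ * ∑ i, f i (tilx ω N)) - ((n : ℝ)⁻¹ * ∑ i, f i xstar)
            - ⟪(n : ℝ)⁻¹ • ∑ i, f' i xstar, tilx ω N - xstar⟫)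
          + (h (tilv ω N) - h vstar - ⟪B xstar, tilv ω N - vstar⟫)))
      / (Fintype.card (Fin N → Fin m → {I : Finset (Fin n) // I.card = b}) : ℝ)
    ≤ κ ^ N * ((((n : ℝ)⁻¹ * ∑ i, f i xt0) - ((n : ℝ)⁻¹ * ∑ i, f i xstar)
            - ⟪(n : ℝ)⁻¹ • ∑ i, f' i xstar, xt0 - xstar⟫)
          + (h vt0 - h vstar - ⟪B xstar, vt0 - vstar⟫)) := by
  classical
  have hn1 : 1 ≤ n := by omega
  have hm0 : (0 : ℝ) < m := by exact_mod_cast hm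
  have : Nonempty {I : Finset (Fin n) // I.card = b} := by
    obtain ⟨I, -, hI⟩ := Finset.exists_subset_card_eq
      (s := (Finset.univ : Finset (Fin n))) (n := b) (by simpa using hbn)
    exact ⟨⟨I, hI⟩⟩
  obtain ⟨D, hD⟩ : ∃ D : EuclideanSpace ℝ (Fin d) → ℝ, ∀ z, D z = (n : ℝ)⁻¹ * ∑ i, f i z
      - (n : ℝ)⁻¹ * ∑ i, f i xstar - ⟪(n : ℝ)⁻¹ • ∑ i, f' i xstar, z - xstar⟫ := ⟨_, fun _ => rfl⟩
  obtain ⟨H, hH⟩ : ∃ H : EuclideanSpace ℝ (Fin r) → ℝ, ∀ u,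
      H u = h u - h vstar - ⟪B xstar, u - vstar⟫ := ⟨_, fun _ => rfl⟩
  simp only [← hD, ← hH]
  have hcard : (0 : ℝ) < Fintype.card (Fin N → Fin m → {I : Finset (Fin n) // I.card = b}) := by
    exact_mod_cast Fintype.card_pos
  rw [div_le_iff₀ hcard]
  rcases subsingleton_or_nontrivial (EuclideanSpace ℝ (Fin d)) with hE | hE
  · have hF : ∀ u : EuclideanSpace ℝ (Fin r), u = vstar := fun u => by
      rw [← hBBt u, ← hBBt vstar,
        Subsingleton.elim (ContinuousLinearMap.adjoint B u) (ContinuousLinearMap.adjoint B vstar)]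
    have hD0 : ∀ z, D z = 0 := fun z => by rw [hD, Subsingleton.elim z xstar]; simp
    have hH0 : ∀ u, H u = 0 := fun u => by rw [hH, hF u]; simp
    simp [hD0, hH0]
  have hLmax0 : 0 ≤ Lmax := by
    obtain ⟨p, q, hpq⟩ := exists_pair_ne (EuclideanSpace ℝ (Fin d))
    obtain ⟨i, rfl⟩ := hLmax.1
    exact nonneg_of_mul_nonneg_left ((norm_nonneg _).trans (hLip i p q))
      (norm_pos_iff.2 (sub_ne_zero.2 hpq))
  have hLip' : ∀ i x y, ‖f' i x - f' i y‖ ≤ Lmax * ‖x - y‖ := fun i x y =>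
    (hLip i x y).trans (mul_le_mul_of_nonneg_right (hLmax.2 ⟨i, rfl⟩) (norm_nonneg _))
  have hM0 : 0 ≤ M := by
    have h1 : (2 : ℝ) ≤ n := by exact_mod_cast hn
    have h2 : (b : ℝ) ≤ n := by exact_mod_cast hbn
    rw [hM]
    exact mul_nonneg (by positivity)
      (div_nonneg (by linarith) (mul_nonneg (Nat.cast_nonneg _) (by linarith)))
  have hκ0 : 0 ≤ κ := by
    have : 0 < 1 - γ * M := by linarith
    rw [hκ]
    positivity
  have hγK : γ * (1 / β) ≤ 1 := by
    rw [mul_one_div, div_le_one hβ0]; exact hγβ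
  have hmean := ConvexOn.mean hconv
  have hDμ : ∀ z, μf / 2 * ‖z - xstar‖ ^ 2 ≤ D z := fun z => by
    rw [hD]
    exact hstrongf.sq_norm_sub_le_of_strongly_convex
      (HasGradientAt.mean fun i => hgrad i xstar) z
  have hD0 : ∀ z, 0 ≤ D z := fun z => (by positivity : (0 : ℝ) ≤ _).trans (hDμ z)
  have hH0 : ∀ u ∈ S, 0 ≤ H u := fun u hu => by rw [hH]; exact hopt2 u hu
  have hDconv : ConvexOn ℝ Set.univ D := by
    refine ⟨convex_univ, fun z _ w _ p q hp hq hpq => ?_⟩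
    have h1 := hmean.2 (Set.mem_univ z) (Set.mem_univ w) hp hq hpq
    have h2 : p • z + q • w - xstar = p • (z - xstar) + q • (w - xstar) := by
      rw [smul_sub, smul_sub, sub_add_sub_comm, ← add_smul, hpq, one_smul]
    simp only [smul_eq_mul] at h1
    rw [hD, hD z, hD w, h2, inner_add_right, real_inner_smul_right, real_inner_smul_right,
      smul_eq_mul, smul_eq_mul]
    linear_combination h1 + ((n : ℝ)⁻¹ * ∑ i, f i xstar) * hpq
  have hHconv : ConvexOn ℝ S H := by
    refine ⟨hhconv.1, fun z hz w hw p q hp hq hpq => ?_⟩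
    have h1 := hhconv.2 hz hw hp hq hpq
    have h2 : p • z + q • w - vstar = p • (z - vstar) + q • (w - vstar) := by
      rw [smul_sub, smul_sub, sub_add_sub_comm, ← add_smul, hpq, one_smul]
    simp only [smul_eq_mul] at h1
    rw [hH, hH z, hH w, h2, inner_add_right, real_inner_smul_right, real_inner_smul_right,
      smul_eq_mul, smul_eq_mul]
    linear_combination h1 + h vstar * hpq
  have hstep : ∀ ω, ∀ s : Fin N, ∀ k : Fin m, IsPrimalDualStep B S h γ (x ω s k)
      ((b : ℝ)⁻¹ • ∑ i ∈ (ω s k).1, (f' i (x ω s k) - f' i (tilx ω s))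
        + (n : ℝ)⁻¹ • ∑ i, f' i (tilx ω s)) (x ω s (k + 1)) (v ω s (k + 1)) := fun ω s k =>
    .of_isMin hBBt hγ0 hhconv (hvmem ω s k) (hy ω s k) (hx ω s k) (hvmin ω s k)
  have hagree := fun ω ω' s k => eq_of_agree_before (T := tilx) (X := x) (ω := ω) (ω' := ω')
    (s := s) (k := k) (fun ω ω' => by rw [htilx0, htilx0]) hx0
    (fun ω ω' s k hω hT hX => by
      have h1 := hstep ω' s k
      rw [← hω, ← hT, ← hX] at h1
      have h2 := (hstep ω s k).norm_sub_le hγ0.le h1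
      rw [sub_self, norm_zero, mul_zero] at h2
      exact sub_eq_zero.1 (norm_le_zero_iff.1 h2))
    (fun ω ω' s hk => by
      rw [htilx, htilx, Finset.sum_congr rfl fun k hk' => hk k (Finset.mem_range.1 hk')])
  have hrec : ∀ (s : Fin N) (k : Fin m),
      ∑ ω, (2 * γ * (D (x ω s (k + 1)) + H (v ω s (k + 1))) + ‖x ω s (k + 1) - xstar‖ ^ 2)
        ≤ ∑ ω, (‖x ω s k - xstar‖ ^ 2 + 2 * γ ^ 2 * M * (D (x ω s k) + D (tilx ω s))) := by
    intro s k
    refine sum_le_sum_of_forall_sum_update_le _ _ s k fun ω => ?_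
    have h1 : ∀ a, tilx (Function.update ω s (Function.update (ω s) k a)) s = tilx ω s
        ∧ x (Function.update ω s (Function.update (ω s) k a)) s k = x ω s k := fun a =>
      hagree _ _ s k (fun s' hs' => by rw [Function.update_of_ne hs'.ne])
        (fun j hj => by rw [Function.update_self, Function.update_of_ne hj.ne])
    simp only [h1]
    refine sum_svrg_step_le hconv hgrad hLmax0 hLip' hn hb1 hbn hM hγ0 hγK hfLip hvstar hopt1
      hD hH fun a => ?_
    have h2 := hstep (Function.update ω s (Function.update (ω s) k a)) s k
    rwa [(h1 a).1, (h1 a).2, Function.update_self, Function.update_self] at h2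
  have hw : ∑ _k ∈ Finset.range m, (m : ℝ)⁻¹ = 1 := by
    rw [Finset.sum_const, Finset.card_range, nsmul_eq_mul, mul_inv_cancel₀ hm0.ne']
  have hepoch : ∀ s : Fin N, ∑ ω, (D (tilx ω (s + 1)) + H (tilv ω (s + 1)))
      ≤ κ * ∑ ω, D (tilx ω s) := by
    intro s
    have h1 := sum_le_of_epoch_recursion (e := fun k => ∑ ω, ‖x ω s k - xstar‖ ^ 2)
      (d := fun k => ∑ ω, D (x ω s k)) (r := fun k => ∑ ω, (D (x ω s k) + H (v ω s k)))
      hγ0 hM0 hγM hμf hm hκ (fun k => by positivity)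
      (fun k => Finset.sum_nonneg fun ω _ => hD0 _)
      (by rw [Finset.mul_sum]; exact Finset.sum_le_sum fun ω _ => hDμ _)
      (fun k hk => Finset.sum_le_sum fun ω _ =>
        le_add_of_nonneg_right (hH0 _ (hvmem ω s ⟨k, hk⟩)))
      (fun k hk => by
        have h2 := hrec s ⟨k, hk⟩
        simpa only [Finset.sum_add_distrib, ← Finset.mul_sum, hx0] using h2)
    simp only [hx0] at h1
    refine le_trans ?_ h1
    rw [Finset.sum_comm, Finset.mul_sum]
    refine Finset.sum_le_sum fun ω _ => ?_
    rw [htilx, htilv, Finset.smul_sum, Finset.smul_sum, Finset.sum_add_distrib, mul_add,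
      Finset.mul_sum, Finset.mul_sum]
    exact add_le_add
      (hDconv.map_sum_le (fun _ _ => by positivity) hw fun _ _ => Set.mem_univ _)
      (hHconv.map_sum_le (fun _ _ => by positivity) hw
        fun k hk => hvmem ω s ⟨k, Finset.mem_range.1 hk⟩)
  have htilvmem : ∀ ω, ∀ s ≤ N, tilv ω s ∈ S := by
    rintro ω (_ | s) hs
    · rw [htilv0]; exact hvt0
    · rw [htilv ω ⟨s, hs⟩, Finset.smul_sum]
      exact hhconv.1.sum_mem (fun _ _ => by positivity) hw
        fun k hk => hvmem ω ⟨s, hs⟩ ⟨k, Finset.mem_range.1 hk⟩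
  have hmain : ∀ s ≤ N, ∑ ω, (D (tilx ω s) + H (tilv ω s)) ≤ κ ^ s * (D xt0 + H vt0)
      * Fintype.card (Fin N → Fin m → {I : Finset (Fin n) // I.card = b}) := by
    intro s
    induction s with
    | zero =>
      intro _
      simp only [htilx0, htilv0, Finset.sum_const, Finset.card_univ, nsmul_eq_mul]
      linarith
    | succ s ih =>
      intro hs
      calc _ ≤ κ * ∑ ω, D (tilx ω s) := hepoch ⟨s, hs⟩
        _ ≤ κ * ∑ ω, (D (tilx ω s) + H (tilv ω s)) := by
          gcongr with ω
          exact le_add_of_nonneg_right (hH0 _ (htilvmem ω s (by omega)))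
        _ ≤ κ * (κ ^ s * (D xt0 + H vt0) * _) := by gcongr; exact ih (by omega)
        _ = _ := by ring
  exact hmain N le_rfl
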